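/- arXiv:2309.14155 — 14 statements merged into one kernel-verified Lean document; each statement's English description precedes it below -/
import Mathlib

section
/- Let a, b, c be vectors in a real inner product space, and let L ≥ 0, η ≥ 0 satisfy L²η² ≤ 1. If ⟨a − c, b⟩ ≥ 0 and ‖b − c‖² ≤ L²η²‖b − a‖², then ‖c‖ ≤ ‖a‖. -/
open RealInnerProductSpace

/-- Sum-of-squares lemma (Lemma 4.1, Cai et al. 2022): if `⟨a - c, b⟩ ≥ 0` and
`‖b - c‖² ≤ L²η²‖b - a‖²` with `L²η² ≤ 1`, then `‖c‖ ≤ ‖a‖`. -/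
theorem sos_norm_nonincreasing {E : Type*} [NormedAddCommGroup E] [InnerProductSpace ℝ E]
    (a b c : E) (L η : ℝ) (hL : 0 ≤ L) (hη : 0 ≤ η)
    (hstep : L ^ 2 * η ^ 2 ≤ 1)
    (h1 : 0 ≤ ⟪a - c, b⟫)
    (h2 : ‖b - c‖ ^ 2 ≤ L ^ 2 * η ^ 2 * ‖b - a‖ ^ 2) :
    ‖c‖ ≤ ‖a‖ := by
  have h3 : ‖b - c‖ ^ 2 ≤ ‖b - a‖ ^ 2 :=
    h2.trans (mul_le_of_le_one_left (sq_nonneg _) hstep)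
  rw [norm_sub_sq_real, norm_sub_sq_real] at h3
  rw [inner_sub_left] at h1
  have e1 := real_inner_comm a b
  have e2 := real_inner_comm c b
  exact (pow_le_pow_iff_left₀ (norm_nonneg c) (norm_nonneg a) two_ne_zero).mp (by linarith)
end

section
/- Let E be a real inner product space, F : E → E a monotone and L-Lipschitz operator, and η > 0 with L η ≤ 1. Fix z ∈ E and set z̃ = z − η F(z) and z' = z − η F(z̃). Then ‖F(z')‖ ≤ ‖F(z)‖, i.e. the operator norm along the extragradient iteration is non-increasing. -/
open RealInnerProductSpace

/-- For one extragradient step with `Lη ≤ 1`, the operator norm is non-increasing: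
`‖F z'‖ ≤ ‖F z‖`. -/
theorem eg_operator_norm_nonincreasing {E : Type*} [NormedAddCommGroup E] [InnerProductSpace ℝ E]
    (F : E → E) (L η : ℝ) (hη : 0 < η) (hstep : L * η ≤ 1)
    (hmono : ∀ x y : E, 0 ≤ ⟪F x - F y, x - y⟫)
    (hlip : ∀ x y : E, ‖F x - F y‖ ≤ L * ‖x - y‖)
    (z ztil z' : E)
    (hztil : ztil = z - η • F z)
    (hz' : z' = z - η • F ztil) :
    ‖F z'‖ ≤ ‖F z‖ := by
  have h1 : 0 ≤ ⟪F z - F z', F ztil⟫ := by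
    have h := hmono z z'
    have e : z - z' = η • F ztil := by rw [hz']; abel
    rw [e, real_inner_smul_right] at h
    exact nonneg_of_mul_nonneg_right h hη
  have h2 : ‖F ztil - F z'‖ ≤ ‖F ztil - F z‖ := by
    have h := hlip ztil z'
    have e : ztil - z' = η • (F ztil - F z) := by
      rw [smul_sub, hz']
      nth_rewrite 1 [hztil]
      abel
    rw [e, norm_smul, Real.norm_of_nonneg hη.le, ← mul_assoc] at h
    exact h.trans (mul_le_of_le_one_left (norm_nonneg _) hstep)
  have h3 : ‖F ztil - F z'‖ ^ 2 ≤ ‖F ztil - F z‖ ^ 2 :=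
    pow_le_pow_left₀ (norm_nonneg _) h2 2
  rw [norm_sub_sq_real, norm_sub_sq_real] at h3
  rw [inner_sub_left, real_inner_comm, real_inner_comm (F ztil) (F z')] at h1
  refine (sq_le_sq₀ (norm_nonneg _) (norm_nonneg _)).1 ?_
  linarith
end

section
/- Let E be a real inner product space, F : E → E a monotone and L-Lipschitz operator with F(z*) = 0 for some z* ∈ E, and η > 0. Fix z ∈ E and set z̃ = z − η F(z) and z' = z − η F(z̃). Then ‖z' − z*‖² ≤ ‖z − z*‖² − (1 − L²η²) η² ‖F(z)‖². -/
open RealInnerProductSpace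

/-- One-step distance decrease for the extragradient method (Euclidean specialization of
Lemma 4.2): `‖z' − z*‖² ≤ ‖z − z*‖² − (1 − L²η²)η²‖F z‖²`. -/
theorem eg_distance_decrease {E : Type*} [NormedAddCommGroup E] [InnerProductSpace ℝ E]
    (F : E → E) (L η : ℝ) (hη : 0 < η)
    (hmono : ∀ x y : E, 0 ≤ ⟪F x - F y, x - y⟫)
    (hlip : ∀ x y : E, ‖F x - F y‖ ≤ L * ‖x - y‖)
    (zstar : E) (hzstar : F zstar = 0)
    (z ztil z' : E)
    (hztil : ztil = z - η • F z)
    (hz' : z' = z - η • F ztil) :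
    ‖z' - zstar‖ ^ 2 ≤ ‖z - zstar‖ ^ 2 - (1 - L ^ 2 * η ^ 2) * η ^ 2 * ‖F z‖ ^ 2 := by
  have hm := hmono ztil zstar
  have hl := hlip ztil z
  have e1 : ztil - zstar = (z - zstar) - η • F z := by rw [hztil]; abel
  have e2 : ztil - z = -(η • F z) := by rw [hztil]; abel
  have e3 : z' - zstar = (z - zstar) - η • F ztil := by rw [hz']; abel
  rw [hzstar, sub_zero, e1, inner_sub_right, inner_smul_right] at hm
  rw [e2, norm_neg, norm_smul, Real.norm_of_nonneg hη.le] at hl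
  have hl2 := pow_le_pow_left₀ (norm_nonneg _) hl 2
  rw [norm_sub_sq_real] at hl2
  rw [e3, norm_sub_sq_real, inner_smul_right, norm_smul, Real.norm_of_nonneg hη.le,
    real_inner_comm]
  have h1 := mul_le_mul_of_nonneg_left hl2 (sq_nonneg η)
  have h2 := mul_nonneg hη.le hm
  nlinarith [h1, h2]
end

section
/- Let E be a real inner product space, F : E → E a monotone and L-Lipschitz operator with F(z*) = 0 for some z* ∈ E, and η > 0 with L η < 1. Let (z_t) be the extragradient iterates z_{t+1} = z_t − η F(z_t − η F(z_t)) started from z_0. Then for every T ≥ 1 there exists t with 0 ≤ t < T such that ‖F(z_t)‖² ≤ ‖z_0 − z*‖² / ((1 − L²η²) η² T). -/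
open RealInnerProductSpace

/-- Best-iterate convergence of the extragradient method (Euclidean specialization of
Lemma 4.2): some iterate `t < T` satisfies
`‖F (z t)‖² ≤ ‖z 0 − z*‖² / ((1 − L²η²) η² T)`. -/
theorem eg_best_iterate {E : Type*} [NormedAddCommGroup E] [InnerProductSpace ℝ E]
    (F : E → E) (L η : ℝ) (hη : 0 < η) (hstep : L * η < 1)
    (hmono : ∀ x y : E, 0 ≤ ⟪F x - F y, x - y⟫)
    (hlip : ∀ x y : E, ‖F x - F y‖ ≤ L * ‖x - y‖)
    (zstar : E) (hzstar : F zstar = 0)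
    (z : ℕ → E)
    (hrec : ∀ t, z (t + 1) = z t - η • F (z t - η • F (z t))) :
    ∀ T : ℕ, 1 ≤ T → ∃ t < T,
      ‖F (z t)‖ ^ 2 ≤ ‖z 0 - zstar‖ ^ 2 / ((1 - L ^ 2 * η ^ 2) * η ^ 2 * T) := by
  intro T hT
  by_cases hL : L < 0
  · have hsub : ∀ x y : E, x - y = 0 := by
      intro x y
      have h1 := hlip x y
      have h2 := norm_nonneg (F x - F y)
      have h3 := norm_nonneg (x - y)
      apply norm_eq_zero.mp
      nlinarith
    refine ⟨0, by omega, ?_⟩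
    have h1 := hsub (F (z 0)) 0
    rw [sub_zero] at h1
    rw [h1, hsub (z 0) zstar]
    simp
  push Not at hL
  have hc : 0 < 1 - L ^ 2 * η ^ 2 := by
    have : 0 ≤ L * η := by positivity
    nlinarith
  have key : ∀ t, (1 - L ^ 2 * η ^ 2) * η ^ 2 * ‖F (z t)‖ ^ 2 ≤
      ‖z t - zstar‖ ^ 2 - ‖z (t + 1) - zstar‖ ^ 2 := by
    intro t
    rw [hrec t]
    have hm := hmono (z t - η • F (z t)) zstar
    have hl := hlip (z t - η • F (z t)) (z t)
    generalize F (z t - η • F (z t)) = g at *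
    generalize F (z t) = f at *
    rw [hzstar, sub_zero] at hm
    have e1 : z t - η • f - zstar = (z t - zstar) - η • f := by abel
    have e2 : z t - η • g - zstar = (z t - zstar) - η • g := by abel
    have e3 : z t - η • f - z t = -(η • f) := by abel
    rw [e1, inner_sub_right, real_inner_smul_right] at hm
    rw [e3, norm_neg, norm_smul, Real.norm_of_nonneg hη.le] at hl
    have hl2 : ‖g - f‖ ^ 2 ≤ (L * (η * ‖f‖)) ^ 2 := by gcongr
    rw [norm_sub_sq_real] at hl2
    rw [e2, norm_sub_sq_real (z t - zstar), real_inner_smul_right, norm_smul,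
      Real.norm_of_nonneg hη.le, real_inner_comm]
    have h1 := mul_le_mul_of_nonneg_left hl2 (sq_nonneg η)
    have h2 := mul_nonneg hη.le hm
    nlinarith
  have hsum : ∀ n : ℕ, ∑ t ∈ Finset.range n, (1 - L ^ 2 * η ^ 2) * η ^ 2 * ‖F (z t)‖ ^ 2 ≤
      ‖z 0 - zstar‖ ^ 2 - ‖z n - zstar‖ ^ 2 := by
    intro n
    induction n with
    | zero => simp
    | succ n ih =>
      rw [Finset.sum_range_succ]
      linarith [key n]
  have hTpos : (0 : ℝ) < T := by exact_mod_cast hT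
  by_contra! hcon
  have hlt : ∑ t ∈ Finset.range T, ‖z 0 - zstar‖ ^ 2 / T <
      ∑ t ∈ Finset.range T, (1 - L ^ 2 * η ^ 2) * η ^ 2 * ‖F (z t)‖ ^ 2 := by
    apply Finset.sum_lt_sum_of_nonempty
    · exact Finset.nonempty_range_iff.mpr (by omega)
    · intro t ht
      have h := hcon t (Finset.mem_range.mp ht)
      rw [div_lt_iff₀ (by positivity)] at h
      rw [div_lt_iff₀ hTpos]
      linarith
  rw [Finset.sum_const, Finset.card_range, nsmul_eq_mul, mul_div_cancel₀ _ hTpos.ne'] at hlt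
  nlinarith [hsum T, sq_nonneg ‖z T - zstar‖]
end

section
/- Let E be a real inner product space, F : E → E a monotone and L-Lipschitz operator with F(z*) = 0 for some z* ∈ E, and η > 0 with L η < 1. Let (z_t) be the extragradient iterates z_{t+1} = z_t − η F(z_t − η F(z_t)) started from z_0. Then for every T ≥ 1, the last iterate satisfies ‖F(z_T)‖² ≤ ‖z_0 − z*‖² / ((1 − L²η²) η² T). -/
open RealInnerProductSpace

/-- Last-iterate convergence of the extragradient method (Euclidean specialization of
Theorem 4.1): `‖F (z T)‖² ≤ ‖z 0 − z*‖² / ((1 − L²η²) η² T)`. -/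
theorem eg_last_iterate {E : Type*} [NormedAddCommGroup E] [InnerProductSpace ℝ E]
    (F : E → E) (L η : ℝ) (hη : 0 < η) (hstep : L * η < 1)
    (hmono : ∀ x y : E, 0 ≤ ⟪F x - F y, x - y⟫)
    (hlip : ∀ x y : E, ‖F x - F y‖ ≤ L * ‖x - y‖)
    (zstar : E) (hzstar : F zstar = 0)
    (z : ℕ → E)
    (hrec : ∀ t, z (t + 1) = z t - η • F (z t - η • F (z t))) :
    ∀ T : ℕ, 1 ≤ T →
      ‖F (z T)‖ ^ 2 ≤ ‖z 0 - zstar‖ ^ 2 / ((1 - L ^ 2 * η ^ 2) * η ^ 2 * T) := by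
  rcases subsingleton_or_nontrivial E with hE | hE
  · intro T hT
    rw [Subsingleton.elim (F (z T)) 0, Subsingleton.elim (z 0 - zstar) 0]
    simp
  have hL : 0 ≤ L := by
    obtain ⟨x, y, hxy⟩ := exists_pair_ne E
    have h1 : 0 < ‖x - y‖ := norm_pos_iff.mpr (sub_ne_zero.mpr hxy)
    have h2 := (norm_nonneg _).trans (hlip x y)
    by_contra hneg
    push Not at hneg
    nlinarith
  have hLη : 0 ≤ L * η := mul_nonneg hL hη.le
  have hq : L ^ 2 * η ^ 2 < 1 := by nlinarith
  have key : ∀ t, ‖F (z (t + 1))‖ ^ 2 ≤ ‖F (z t)‖ ^ 2 ∧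
      (1 - L ^ 2 * η ^ 2) * η ^ 2 * ‖F (z t)‖ ^ 2 + ‖z (t + 1) - zstar‖ ^ 2
        ≤ ‖z t - zstar‖ ^ 2 := by
    intro t
    have m1 := hmono (z t) (z (t + 1))
    have l1 := hlip (z t - η • F (z t)) (z (t + 1))
    have m2 := hmono (z t - η • F (z t)) zstar
    have l2 := hlip (z t) (z t - η • F (z t))
    rw [hzstar, sub_zero] at m2
    have hz := hrec t
    generalize F (z (t + 1)) = c at *
    rw [hz] at m1 l1 ⊢
    generalize F (z t - η • F (z t)) = b at *
    generalize F (z t) = a at *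
    have e1 : z t - η • a - (z t - η • b) = η • (b - a) := by
      rw [smul_sub]; abel
    have e3 : z t - η • a - zstar = (z t - zstar) - η • a := by abel
    have e4 : z t - η • b - zstar = (z t - zstar) - η • b := by abel
    rw [e1, norm_smul, Real.norm_of_nonneg hη.le] at l1
    rw [sub_sub_cancel, norm_smul, Real.norm_of_nonneg hη.le] at l2
    rw [sub_sub_cancel, inner_smul_right, inner_sub_left] at m1
    rw [e3, inner_sub_right, inner_smul_right] at m2
    rw [e4]
    have m1' := nonneg_of_mul_nonneg_right m1 hη
    have l1' := pow_le_pow_left₀ (norm_nonneg _) l1 2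
    have l2' := pow_le_pow_left₀ (norm_nonneg _) l2 2
    have n1 := norm_sub_sq_real b c
    have n2 := norm_sub_sq_real b a
    have n3 := norm_sub_sq_real a b
    have n4 := norm_sub_sq_real (z t - zstar) (η • b)
    rw [norm_smul, Real.norm_of_nonneg hη.le, inner_smul_right] at n4
    rw [real_inner_comm] at n3
    rw [real_inner_comm b] at m1'
    rw [real_inner_comm c] at n1
    rw [real_inner_comm b (z t - zstar)] at n4
    simp only [real_inner_comm] at *
    constructor
    · nlinarith [mul_nonneg (sub_nonneg.mpr hq.le) (sq_nonneg ‖b - a‖)]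
    · rw [n4]
      nlinarith [mul_nonneg hη.le m2, mul_le_mul_of_nonneg_left l2' (sq_nonneg η)]
  have hk : 0 < (1 - L ^ 2 * η ^ 2) * η ^ 2 := mul_pos (sub_pos.mpr hq) (pow_pos hη 2)
  have main : ∀ T : ℕ, (1 - L ^ 2 * η ^ 2) * η ^ 2 * T * ‖F (z T)‖ ^ 2 + ‖z T - zstar‖ ^ 2
      ≤ ‖z 0 - zstar‖ ^ 2 := by
    intro T
    induction T with
    | zero => simp
    | succ t ih =>
      obtain ⟨h1, h2⟩ := key t
      have h3 := mul_le_mul_of_nonneg_left h1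
        (mul_nonneg hk.le (Nat.cast_nonneg (α := ℝ) (t + 1)))
      push_cast at h3 ⊢
      linarith
  intro T hT
  have hT' : (0 : ℝ) < T := by exact_mod_cast hT
  rw [le_div_iff₀ (mul_pos hk hT')]
  have := main T
  nlinarith [sq_nonneg ‖z T - zstar‖]
end

section
/- Let E be a real inner product space, F : E → E an L-Lipschitz operator, and η > 0 with L η ≤ 1. Fix z₀ ∈ E and set z̃ = z₀ − η F(z₀) and z₁ = z₀ − η F(z̃). Then for every z ∈ E, ‖z₁ − z‖² − ‖z₀ − z‖² ≤ 2η ⟨F(z̃), z − z̃⟩. -/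
open RealInnerProductSpace

/-- Per-step gap inequality for the extragradient method (Euclidean specialization of
Lemma A.6): `‖z₁ − z‖² − ‖z₀ − z‖² ≤ 2η⟨F z̃, z − z̃⟩` for every `z`. -/
theorem eg_gap_inequality {E : Type*} [NormedAddCommGroup E] [InnerProductSpace ℝ E]
    (F : E → E) (L η : ℝ) (hη : 0 < η) (hstep : L * η ≤ 1)
    (hlip : ∀ x y : E, ‖F x - F y‖ ≤ L * ‖x - y‖)
    (z₀ ztil z₁ : E)
    (hztil : ztil = z₀ - η • F z₀)
    (hz₁ : z₁ = z₀ - η • F ztil) :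
    ∀ z : E, ‖z₁ - z‖ ^ 2 - ‖z₀ - z‖ ^ 2 ≤ 2 * η * ⟪F ztil, z - ztil⟫ := by
  intro z
  have h1 : ‖F ztil - F z₀‖ ≤ ‖F z₀‖ := by
    have h := hlip ztil z₀
    have e : ‖ztil - z₀‖ = η * ‖F z₀‖ := by
      rw [hztil, sub_sub_cancel_left, norm_neg, norm_smul, Real.norm_of_nonneg hη.le]
    rw [e] at h
    nlinarith [norm_nonneg (F z₀)]
  have h2 : ‖F ztil - F z₀‖ ^ 2 ≤ ‖F z₀‖ ^ 2 := by gcongr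
  rw [norm_sub_sq_real] at h2
  have h3 : ‖z₁ - z‖ ^ 2 = ‖z₀ - z‖ ^ 2 - 2 * (η * ⟪F ztil, z₀ - z⟫) + η ^ 2 * ‖F ztil‖ ^ 2 := by
    have e : z₁ - z = (z₀ - z) - η • F ztil := by rw [hz₁]; abel
    rw [e, norm_sub_sq_real, inner_smul_right, norm_smul, Real.norm_of_nonneg hη.le,
      real_inner_comm]
    ring
  have h4 : ⟪F ztil, z - ztil⟫ = -⟪F ztil, z₀ - z⟫ + η * ⟪F ztil, F z₀⟫ := by
    have e : z - ztil = -(z₀ - z) + η • F z₀ := by rw [hztil]; abel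
    rw [e, inner_add_right, inner_neg_right, inner_smul_right]
  rw [h3, h4]
  nlinarith [mul_le_mul_of_nonneg_left h2 (sq_nonneg η)]
end

section
/- Let E be a real inner product space, F : E → E an L-Lipschitz operator, and η > 0 with L η ≤ 1. Let (z_t) and (z̃_t) be the extragradient sequences z̃_t = z_t − η F(z_t), z_{t+1} = z_t − η F(z̃_t), started from z_0. Then for every z ∈ E and T ≥ 1, the sum ∑_{t=0}^{T−1} ⟨F(z̃_t), z̃_t − z⟩ ≤ ‖z_0 − z‖² / (2η). -/
open RealInnerProductSpace

/-- Telescoped regret bound for the extragradient method (Euclidean core of the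
`O(1/T)` average-iterate convergence in Theorem 4.2):
`∑_{t=0}^{T−1} ⟨F z̃_t, z̃_t − z⟩ ≤ ‖z_0 − z‖²/(2η)`. -/
theorem eg_regret_bound {E : Type*} [NormedAddCommGroup E] [InnerProductSpace ℝ E]
    (F : E → E) (L η : ℝ) (hη : 0 < η) (hstep : L * η ≤ 1)
    (hlip : ∀ x y : E, ‖F x - F y‖ ≤ L * ‖x - y‖)
    (z ztil : ℕ → E)
    (hztil : ∀ t, ztil t = z t - η • F (z t))
    (hrec : ∀ t, z (t + 1) = z t - η • F (ztil t)) :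
    ∀ (w : E) (T : ℕ), 1 ≤ T →
      ∑ t ∈ Finset.range T, ⟪F (ztil t), ztil t - w⟫ ≤ ‖z 0 - w‖ ^ 2 / (2 * η) := by
  intro w T _
  have key : ∀ t, 2 * η * ⟪F (ztil t), ztil t - w⟫ ≤ ‖z t - w‖ ^ 2 - ‖z (t + 1) - w‖ ^ 2 := by
    intro t
    have h1 : ‖F (ztil t) - F (z t)‖ ≤ ‖F (z t)‖ := by
      have h := hlip (ztil t) (z t)
      have e : ‖ztil t - z t‖ = η * ‖F (z t)‖ := by
        rw [hztil t, sub_sub_cancel_left, norm_neg, norm_smul, Real.norm_of_nonneg hη.le]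
      rw [e] at h
      nlinarith [norm_nonneg (F (z t))]
    have h2 : ‖F (ztil t) - F (z t)‖ ^ 2 ≤ ‖F (z t)‖ ^ 2 :=
      pow_le_pow_left₀ (norm_nonneg _) h1 2
    rw [norm_sub_sq_real] at h2
    have e1 : ztil t - w = (z t - w) - η • F (z t) := by rw [hztil t]; abel
    have e2 : z (t + 1) - w = (z t - w) - η • F (ztil t) := by rw [hrec t]; abel
    rw [e2, norm_sub_sq_real (z t - w) (η • F (ztil t)), e1, inner_sub_right, inner_smul_right, inner_smul_right,
      norm_smul, Real.norm_of_nonneg hη.le, real_inner_comm (F (ztil t)) (z t - w)]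
    nlinarith [mul_le_mul_of_nonneg_left h2 (sq_nonneg η)]
  have hs := Finset.sum_le_sum (fun t (_ : t ∈ Finset.range T) => key t)
  rw [← Finset.mul_sum, Finset.sum_range_sub' (fun t => ‖z t - w‖ ^ 2)] at hs
  rw [le_div_iff₀ (by positivity)]
  nlinarith [sq_nonneg ‖z T - w‖]
end

section
/- Let a, b, c, d be vectors in a real inner product space and M ≥ 0. If ⟨a − c, b⟩ ≥ 0 and ‖b − c‖² ≤ M‖b − d‖², then ‖c‖² + 2‖b − c‖² ≤ ‖a‖² + 2‖a − d‖² + (3M − 2/3)‖b − d‖². -/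
open RealInnerProductSpace

/-- Algebraic sum-of-squares backbone of the past-extragradient potential decrease
(Lemma 5.2): if `⟨a − c, b⟩ ≥ 0` and `‖b − c‖² ≤ M‖b − d‖²`, then
`‖c‖² + 2‖b − c‖² ≤ ‖a‖² + 2‖a − d‖² + (3M − 2/3)‖b − d‖²`. -/
theorem peg_sos_backbone {E : Type*} [NormedAddCommGroup E] [InnerProductSpace ℝ E]
    (a b c d : E) (M : ℝ) (hM : 0 ≤ M)
    (h1 : 0 ≤ ⟪a - c, b⟫)
    (h2 : ‖b - c‖ ^ 2 ≤ M * ‖b - d‖ ^ 2) :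
    ‖c‖ ^ 2 + 2 * ‖b - c‖ ^ 2 ≤
      ‖a‖ ^ 2 + 2 * ‖a - d‖ ^ 2 + (3 * M - 2 / 3) * ‖b - d‖ ^ 2 := by
  have key : ‖a‖ ^ 2 + 2 * ‖a - d‖ ^ 2 - 2 / 3 * ‖b - d‖ ^ 2 - ‖c‖ ^ 2 + ‖b - c‖ ^ 2
      - 2 * inner ℝ (a - c) b = 1 / 3 * ‖(a - b) + (2 : ℝ) • (a - d)‖ ^ 2 := by
    simp only [← real_inner_self_eq_norm_sq, inner_add_left, inner_add_right, inner_sub_left,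
      inner_sub_right, real_inner_smul_left, real_inner_smul_right]
    rw [real_inner_comm a b, real_inner_comm a d, real_inner_comm b d, real_inner_comm b c]
    ring
  have hs : 0 ≤ ‖(a - b) + (2 : ℝ) • (a - d)‖ ^ 2 := sq_nonneg _
  linarith
end

section
/- Let E be a real inner product space, F : E → E a monotone and L-Lipschitz operator, and η > 0 with L η ≤ 1/6. Fix z_t, z̃_{t−1} ∈ E and set z̃_t = z_t − η F(z̃_{t−1}) and z_{t+1} = z_t − η F(z̃_t). Then ‖F(z_{t+1})‖² + 2‖F(z_{t+1}) − F(z̃_t)‖² ≤ ‖F(z_t)‖² + 2‖F(z_t) − F(z̃_{t−1})‖². -/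
open RealInnerProductSpace

/-- Euclidean specialization of Lemma 5.2: the potential
`‖F z_t‖² + 2‖F z_t − F z̃_{t−1}‖²` is non-increasing along the past extragradient
method when `Lη ≤ 1/6`. -/
theorem peg_potential_nonincreasing {E : Type*} [NormedAddCommGroup E] [InnerProductSpace ℝ E]
    (F : E → E) (L η : ℝ) (hη : 0 < η) (hstep : L * η ≤ 1 / 6)
    (hmono : ∀ x y : E, 0 ≤ ⟪F x - F y, x - y⟫)
    (hlip : ∀ x y : E, ‖F x - F y‖ ≤ L * ‖x - y‖)
    (zt ztilprev ztilt ztnext : E)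
    (hztilt : ztilt = zt - η • F ztilprev)
    (hztnext : ztnext = zt - η • F ztilt) :
    ‖F ztnext‖ ^ 2 + 2 * ‖F ztnext - F ztilt‖ ^ 2 ≤
      ‖F zt‖ ^ 2 + 2 * ‖F zt - F ztilprev‖ ^ 2 := by
  have h1 : 0 ≤ ⟪F zt - F ztnext, F ztilt⟫ := by
    have h := hmono zt ztnext
    have e : zt - ztnext = η • F ztilt := by rw [hztnext]; abel
    rw [e, real_inner_smul_right] at h
    exact nonneg_of_mul_nonneg_right h hη
  have h2 : ‖F ztnext - F ztilt‖ ≤ 1 / 6 * ‖F ztilprev - F ztilt‖ := by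
    have h := hlip ztnext ztilt
    have e : ztnext - ztilt = η • (F ztilprev - F ztilt) := by
      conv_lhs => rw [hztnext]
      rw [smul_sub]
      nth_rewrite 2 [hztilt]
      abel
    rw [e, norm_smul, Real.norm_of_nonneg hη.le, ← mul_assoc] at h
    exact h.trans (mul_le_mul_of_nonneg_right hstep (norm_nonneg _))
  generalize F zt = a at *
  generalize F ztilprev = b at *
  generalize F ztilt = c at *
  generalize F ztnext = d at *
  have h3 : ‖b - c‖ ≤ ‖a - b‖ + ‖a - c‖ := by
    have := norm_sub_le_norm_sub_add_norm_sub b a c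
    rwa [norm_sub_rev b a] at this
  have h4 := norm_sub_sq_real a c
  have h5 := norm_sub_sq_real d c
  rw [inner_sub_left] at h1
  have h6 : ‖d - c‖ ≤ 1 / 6 * (‖a - b‖ + ‖a - c‖) := by linarith
  have h7 : ‖d - c‖ ^ 2 ≤ (1 / 6 * (‖a - b‖ + ‖a - c‖)) ^ 2 :=
    pow_le_pow_left₀ (norm_nonneg _) h6 2
  nlinarith [sq_nonneg (‖a - b‖ - ‖a - c‖), sq_nonneg ‖a - b‖, sq_nonneg ‖a - c‖]
end

section
/- Let E be a real inner product space, F : E → E an L-Lipschitz operator, and η > 0. Suppose z̃_{t−2}, z̃_{t−1}, z_{t−1} ∈ E and set z_t = z_{t−1} − η F(z̃_{t−1}), z̃_t = z_t − η F(z̃_{t−1}), and z_{t+1} = z_t − η F(z̃_t). Then ‖z̃_t − z_{t+1}‖ ≤ L η² (2‖F(z̃_{t−1})‖ + ‖F(z̃_{t−2})‖), provided also z̃_{t−1} = z_{t−1} − η F(z̃_{t−2}). -/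
open RealInnerProductSpace

/-- Euclidean version of Lemma B.1 (peggrad3): for the past extragradient method,
`‖z̃_t − z_{t+1}‖ ≤ Lη²(2‖F z̃_{t−1}‖ + ‖F z̃_{t−2}‖)`. -/
theorem peg_intermediate_distance {E : Type*} [NormedAddCommGroup E] [InnerProductSpace ℝ E]
    (F : E → E) (L η : ℝ) (hη : 0 < η)
    (hlip : ∀ x y : E, ‖F x - F y‖ ≤ L * ‖x - y‖)
    (ztilpp ztilprev ztprev zt ztilt ztnext : E)
    (hzt : zt = ztprev - η • F ztilprev)
    (hztilt : ztilt = zt - η • F ztilprev)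
    (hztnext : ztnext = zt - η • F ztilt)
    (hztilprev : ztilprev = ztprev - η • F ztilpp) :
    ‖ztilt - ztnext‖ ≤ L * η ^ 2 * (2 * ‖F ztilprev‖ + ‖F ztilpp‖) := by
  have h1 : ztilt - ztnext = η • (F ztilt - F ztilprev) := by
    rw [hztnext, smul_sub]
    nth_rewrite 1 [hztilt]
    abel
  have h2 : ‖ztilt - ztilprev‖ ≤ η * (2 * ‖F ztilprev‖ + ‖F ztilpp‖) := by
    have e : ztilt - ztilprev = η • (F ztilpp - (2 : ℝ) • F ztilprev) := by
      have e1 : ztilt - ztilprev =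
          (ztprev - η • F ztilprev - η • F ztilprev) - (ztprev - η • F ztilpp) := by
        rw [← hztilprev, ← hzt, ← hztilt]
      rw [e1]
      module
    rw [e, norm_smul, Real.norm_of_nonneg hη.le]
    apply mul_le_mul_of_nonneg_left _ hη.le
    have := norm_sub_le (F ztilpp) ((2 : ℝ) • F ztilprev)
    rw [norm_smul, Real.norm_of_nonneg (by norm_num : (0 : ℝ) ≤ 2)] at this
    linarith
  rw [h1, norm_smul, Real.norm_of_nonneg hη.le]
  rcases le_or_gt 0 L with hL | hL
  · calc η * ‖F ztilt - F ztilprev‖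
        ≤ η * (L * (η * (2 * ‖F ztilprev‖ + ‖F ztilpp‖))) :=
          mul_le_mul_of_nonneg_left
            ((hlip _ _).trans (mul_le_mul_of_nonneg_left h2 hL)) hη.le
      _ = _ := by ring
  · -- a negative Lipschitz constant forces the space to be trivial
    have hz : ∀ x : E, ‖x‖ = 0 := by
      intro x
      have h := hlip x 0
      rw [sub_zero] at h
      nlinarith [norm_nonneg x, norm_nonneg (F x - F 0)]
    simp [hz]
end

section
/- Let E be a real inner product space, F : E → E an L-Lipschitz operator, and η > 0 with L η ≤ 1/8. Suppose z̃_{t−1}, z̃_t, z_t ∈ E satisfy z̃_t = z_t − η F(z̃_{t−1}), and let z_{t+1} = z_t − η F(z̃_t) and z̃_{t+1} = z_{t+1} − η F(z̃_t). If ‖F(z̃_{t−1})‖ ≤ 2‖F(z̃_t)‖, then (1/2)‖F(z̃_t)‖ ≤ ‖F(z̃_{t+1})‖ ≤ (3/2)‖F(z̃_t)‖. -/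
open RealInnerProductSpace

/-- Inductive step of the Euclidean version of Lemma B.2 (peggrad1, Chavdarova et al. 2021):
if `‖F z̃_{t−1}‖ ≤ 2‖F z̃_t‖` and `Lη ≤ 1/8`, then
`(1/2)‖F z̃_t‖ ≤ ‖F z̃_{t+1}‖ ≤ (3/2)‖F z̃_t‖`. -/
theorem peg_grad_ratio {E : Type*} [NormedAddCommGroup E] [InnerProductSpace ℝ E]
    (F : E → E) (L η : ℝ) (hη : 0 < η) (hstep : L * η ≤ 1 / 8)
    (hlip : ∀ x y : E, ‖F x - F y‖ ≤ L * ‖x - y‖)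
    (ztilprev zt ztilt ztnext ztilnext : E)
    (hztilt : ztilt = zt - η • F ztilprev)
    (hztnext : ztnext = zt - η • F ztilt)
    (hztilnext : ztilnext = ztnext - η • F ztilt)
    (hratio : ‖F ztilprev‖ ≤ 2 * ‖F ztilt‖) :
    (1 / 2) * ‖F ztilt‖ ≤ ‖F ztilnext‖ ∧ ‖F ztilnext‖ ≤ (3 / 2) * ‖F ztilt‖ := by
  have hd : ztilnext - ztilt = η • (F ztilprev - (2 : ℝ) • F ztilt) := by
    rw [hztilnext, hztnext]
    have h : zt = ztilt + η • F ztilprev := by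
      rw [eq_sub_iff_add_eq] at hztilt
      exact hztilt.symm
    rw [h]
    module
  have h1 := hlip ztilnext ztilt
  rw [hd, norm_smul, Real.norm_of_nonneg hη.le, ← mul_assoc] at h1
  have h2 : ‖F ztilprev - (2 : ℝ) • F ztilt‖ ≤ 4 * ‖F ztilt‖ := by
    have h := norm_sub_le (F ztilprev) ((2 : ℝ) • F ztilt)
    rw [norm_smul, Real.norm_of_nonneg (by norm_num : (0 : ℝ) ≤ 2)] at h
    linarith
  have h3 := mul_le_mul_of_nonneg_right hstep (norm_nonneg (F ztilprev - (2 : ℝ) • F ztilt))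
  have h4 := norm_sub_norm_le (F ztilnext) (F ztilt)
  have h5 := norm_sub_norm_le (F ztilt) (F ztilnext)
  rw [norm_sub_rev] at h5
  constructor <;> linarith
end

section
/- Let E be a real inner product space, F : E → E a monotone and L-Lipschitz operator with F(z*) = 0 for some z* ∈ E, and η > 0 with L η ≤ 1/35. Let (z_t) and (z̃_t) be the past extragradient sequences with initialization z̃_0 = z_0 and, for all t ≥ 0, z_{t+1} = z_t − η F(z̃_t) and z̃_{t+1} = z_{t+1} − η F(z̃_t). Then for every T ≥ 1, the last iterate satisfies ‖F(z_T)‖² ≤ 16 ‖z_0 − z*‖² / (η² T). -/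
open RealInnerProductSpace

lemma peg_aux_phi {E : Type*} [NormedAddCommGroup E] [InnerProductSpace ℝ E]
    (a' a g h : E) (hm : ⟪a' - a, g⟫ ≤ 0) (hl : ‖a' - g‖ ^ 2 ≤ 1 / 1225 * ‖g - h‖ ^ 2) :
    ‖a'‖ ^ 2 + 2 * ‖a' - g‖ ^ 2 ≤ ‖a‖ ^ 2 + 2 * ‖a - h‖ ^ 2 := by
  have h0 : 0 ≤ ‖(a - g) + (2 : ℝ) • (a - h)‖ ^ 2 := by positivity
  have h1 : 0 ≤ ‖g - h‖ ^ 2 := by positivity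
  have e : ‖(a - g) + (2 : ℝ) • (a - h)‖ ^ 2 + 2 * ‖g - h‖ ^ 2
      = 3 * ‖a - g‖ ^ 2 + 6 * ‖a - h‖ ^ 2 := by
    simp only [← real_inner_self_eq_norm_sq, inner_add_left, inner_add_right, inner_sub_left,
      inner_sub_right, real_inner_smul_left, real_inner_smul_right, real_inner_comm a g,
      real_inner_comm a h, real_inner_comm g h]
    ring
  have e2 : ‖a'‖ ^ 2 - ‖a‖ ^ 2 = ‖a' - g‖ ^ 2 - ‖a - g‖ ^ 2 + 2 * ⟪a' - a, g⟫ := by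
    simp only [norm_sub_sq_real, inner_sub_left]
    ring
  linarith

lemma peg_aux_le {E : Type*} [NormedAddCommGroup E] [InnerProductSpace ℝ E]
    (a h k : E) (hl : ‖a - h‖ ^ 2 ≤ 1 / 1225 * ‖h - k‖ ^ 2) :
    ‖a‖ ^ 2 + 2 * ‖a - h‖ ^ 2 ≤ 2 * ‖h‖ ^ 2 + 8 / 1225 * (‖h‖ ^ 2 + ‖k‖ ^ 2) := by
  have p1 := parallelogram_law_with_norm ℝ (a - h) h
  have p2 := parallelogram_law_with_norm ℝ h k
  rw [sub_add_cancel] at p1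
  nlinarith [sq_nonneg ‖a - h - h‖, sq_nonneg ‖h + k‖]

lemma peg_aux_D {E : Type*} [NormedAddCommGroup E] [InnerProductSpace ℝ E]
    (d g h : E) (hm : 0 ≤ ⟪g, d - h⟫) :
    ‖d - g‖ ^ 2 ≤ ‖d‖ ^ 2 + ‖g - h‖ ^ 2 - ‖h‖ ^ 2 := by
  rw [norm_sub_sq_real, norm_sub_sq_real, real_inner_comm]
  rw [inner_sub_right] at hm
  linarith

lemma peg_aux_two {E : Type*} [NormedAddCommGroup E] [InnerProductSpace ℝ E]
    (h k : E) : ‖(2 : ℝ) • h - k‖ ^ 2 ≤ 5 * (‖h‖ ^ 2 + ‖k‖ ^ 2) := by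
  have h1 : ‖(2 : ℝ) • h - k‖ ≤ 2 * ‖h‖ + ‖k‖ := by
    refine (norm_sub_le _ _).trans ?_
    rw [norm_smul]; norm_num
  have h2 := pow_le_pow_left₀ (norm_nonneg _) h1 2
  nlinarith [sq_nonneg (‖h‖ - 2 * ‖k‖)]

/-- Euclidean specialization of Theorem 5.1: last-iterate convergence of the past
extragradient method, `‖F (z T)‖² ≤ 16‖z 0 − z*‖²/(η² T)` for all `T ≥ 1`. -/
theorem peg_last_iterate {E : Type*} [NormedAddCommGroup E] [InnerProductSpace ℝ E]
    (F : E → E) (L η : ℝ) (hη : 0 < η) (hstep : L * η ≤ 1 / 35)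
    (hmono : ∀ x y : E, 0 ≤ ⟪F x - F y, x - y⟫)
    (hlip : ∀ x y : E, ‖F x - F y‖ ≤ L * ‖x - y‖)
    (zstar : E) (hzstar : F zstar = 0)
    (z ztil : ℕ → E)
    (hinit : ztil 0 = z 0)
    (hz : ∀ t, z (t + 1) = z t - η • F (ztil t))
    (hztil : ∀ t, ztil (t + 1) = z (t + 1) - η • F (ztil t)) :
    ∀ T : ℕ, 1 ≤ T → ‖F (z T)‖ ^ 2 ≤ 16 * ‖z 0 - zstar‖ ^ 2 / (η ^ 2 * T) := by
  have lip : ∀ x y : E, ‖η • F x - η • F y‖ ^ 2 ≤ 1 / 1225 * ‖x - y‖ ^ 2 := by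
    intro x y
    have h1 : ‖η • F x - η • F y‖ ≤ 1 / 35 * ‖x - y‖ := by
      rw [← smul_sub, norm_smul, Real.norm_of_nonneg hη.le]
      nlinarith [hlip x y, mul_le_mul_of_nonneg_right hstep (norm_nonneg (x - y)),
        mul_le_mul_of_nonneg_left (hlip x y) hη.le]
    have h2 := pow_le_pow_left₀ (norm_nonneg _) h1 2
    linarith
  have mono : ∀ x y : E, 0 ≤ ⟪η • F x - η • F y, x - y⟫ := by
    intro x y
    rw [← smul_sub, real_inner_smul_left]
    exact mul_nonneg hη.le (hmono x y)
  obtain ⟨G, hG0, hG⟩ : ∃ G : ℕ → E, G 0 = 0 ∧ ∀ t, G (t + 1) = η • F (ztil t) :=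
    ⟨fun n => Nat.casesOn n 0 (fun t => η • F (ztil t)), rfl, fun _ => rfl⟩
  have zs : ∀ t, z (t + 1) = z t - G (t + 1) := fun t => by rw [hz, hG]
  have zt : ∀ t, ztil t = z t - G t := by
    intro t
    cases t with
    | zero => rw [hinit, hG0, sub_zero]
    | succ t => rw [hztil, hG]
  have lA : ∀ t, ‖η • F (z (t + 1)) - G (t + 1)‖ ^ 2 ≤ 1 / 1225 * ‖G (t + 1) - G t‖ ^ 2 := by
    intro t
    have h := lip (z (t + 1)) (ztil t)
    rw [← hG, zs, zt, show z t - G (t + 1) - (z t - G t) = -(G (t + 1) - G t) by abel,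
      norm_neg, ← zs] at h
    exact h
  have phi : ∀ t, ‖η • F (z (t + 1))‖ ^ 2 + 2 * ‖η • F (z (t + 1)) - G (t + 1)‖ ^ 2
      ≤ ‖η • F (z t)‖ ^ 2 + 2 * ‖η • F (z t) - G t‖ ^ 2 := by
    intro t
    refine peg_aux_phi _ _ _ _ ?_ (lA t)
    have h := mono (z (t + 1)) (z t)
    rw [show z (t + 1) - z t = -G (t + 1) by rw [zs]; abel, inner_neg_right] at h
    linarith
  have dD : ∀ t, ‖z (t + 1) - zstar‖ ^ 2
      ≤ ‖z t - zstar‖ ^ 2 + ‖G (t + 1) - G t‖ ^ 2 - ‖G t‖ ^ 2 := by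
    intro t
    have h := mono (ztil t) zstar
    rw [hzstar, smul_zero, sub_zero, ← hG, zt, sub_right_comm] at h
    have := peg_aux_D _ _ _ h
    rwa [sub_right_comm, ← zs] at this
  have lG : ∀ t, ‖G (t + 2) - G (t + 1)‖ ^ 2 ≤ 5 / 1225 * (‖G (t + 1)‖ ^ 2 + ‖G t‖ ^ 2) := by
    intro t
    have h := lip (ztil (t + 1)) (ztil t)
    rw [← hG, ← hG, zt, zt, zs,
      show z t - G (t + 1) - G (t + 1) - (z t - G t) = -((2 : ℝ) • G (t + 1) - G t) by
        rw [two_smul]; abel, norm_neg] at h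
    linarith [peg_aux_two (G (t + 1)) (G t)]
  have main : ∀ T : ℕ, T * (‖η • F (z T)‖ ^ 2 + 2 * ‖η • F (z T) - G T‖ ^ 2)
      + 8 * ‖z (T + 1) - zstar‖ ^ 2 + ‖G T‖ ^ 2 ≤ 16 * ‖z 0 - zstar‖ ^ 2 := by
    intro T
    induction T with
    | zero =>
      have h1 := dD 0
      have h2 := lip (ztil 0) zstar
      rw [hzstar, smul_zero, sub_zero, ← hG, hinit] at h2
      simp only [hG0, sub_zero, zero_add, norm_zero, Nat.cast_zero, zero_mul] at *
      nlinarith [sq_nonneg ‖z 0 - zstar‖]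
    | succ T ih =>
      have h1 := dD (T + 1)
      have h2 := lG T
      have h3 := peg_aux_le _ _ _ (lA T)
      have h4 := mul_le_mul_of_nonneg_left (phi T) (Nat.cast_nonneg (α := ℝ) T)
      push_cast
      rw [add_mul, one_mul]
      have h5 := sq_nonneg ‖G (T + 1)‖
      have h6 := sq_nonneg ‖G T‖
      linarith
  intro T hT
  have hT' : (0 : ℝ) < T := by exact_mod_cast hT
  rw [le_div_iff₀ (by positivity)]
  have h := main T
  have e : ‖η • F (z T)‖ ^ 2 = η ^ 2 * ‖F (z T)‖ ^ 2 := by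
    rw [norm_smul, Real.norm_of_nonneg hη.le, mul_pow]
  rw [e, mul_add] at h
  have h1 : 0 ≤ (T : ℝ) * (2 * ‖η • F (z T) - G T‖ ^ 2) := by positivity
  nlinarith [sq_nonneg ‖z (T + 1) - zstar‖, sq_nonneg ‖G T‖]
end

section
/- Let E₁ and E₂ be real inner product spaces and f : E₁ × E₂ → ℝ be differentiable. Suppose that for every y ∈ E₂ the function x ↦ f(x, y) is convex and for every x ∈ E₁ the function y ↦ f(x, y) is concave. For (x₀, y₀) ∈ E₁ × E₂ let g₁ = ∇_x f(x₀, y₀) and g₂ = ∇_y f(x₀, y₀) be the partial gradients. Then for all x ∈ E₁ and y ∈ E₂, f(x₀, y) − f(x, y₀) ≤ √(‖g₁‖² + ‖g₂‖²) · √(‖x₀ − x‖² + ‖y₀ − y‖²). -/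
open RealInnerProductSpace

theorem convex_grad_ineq_aux {E : Type*} [NormedAddCommGroup E] [InnerProductSpace ℝ E]
    (h : E → ℝ) (hc : ConvexOn ℝ Set.univ h) (x₀ g : E)
    (hg : HasFDerivAt h (innerSL ℝ g) x₀) (x : E) :
    h x₀ - h x ≤ ‖g‖ * ‖x₀ - x‖ := by
  have hc' : ConvexOn ℝ Set.univ (h ∘ (AffineMap.lineMap x₀ x : ℝ →ᵃ[ℝ] E)) := by
    simpa using hc.comp_affineMap (AffineMap.lineMap x₀ x : ℝ →ᵃ[ℝ] E)
  have hl : HasDerivAt (AffineMap.lineMap x₀ x : ℝ → E) (x - x₀) 0 :=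
    AffineMap.hasDerivAt_lineMap
  have hd : HasDerivAt (h ∘ (AffineMap.lineMap x₀ x : ℝ →ᵃ[ℝ] E))
      (innerSL ℝ g (x - x₀)) 0 := by
    refine HasFDerivAt.comp_hasDerivAt (0 : ℝ) ?_ hl
    simpa using hg
  have h1 := hc'.le_slope_of_hasDerivAt (Set.mem_univ 0) (Set.mem_univ 1) one_pos hd
  simp [slope_def_field] at h1
  have h2 := real_inner_le_norm g (x₀ - x)
  have h3 : inner ℝ g (x₀ - x) = - inner ℝ g (x - x₀) := by
    rw [← inner_neg_right, neg_sub]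
  rw [inner_sub_right] at h3 h2
  try rw [inner_sub_right] at h1
  linarith

/-- For a differentiable convex-concave function `f` on `E₁ × E₂`, the primal–dual
gap at `(x₀, y₀)` is bounded by the norm of the saddle gradient times the distance:
`f(x₀, y) − f(x, y₀) ≤ √(‖g₁‖² + ‖g₂‖²) · √(‖x₀ − x‖² + ‖y₀ − y‖²)`,
where `g₁ = ∇ₓ f(x₀, y₀)` and `g₂ = ∇_y f(x₀, y₀)` (the gradient hypotheses are
expressed via the Riesz pairing `innerSL`). -/
theorem saddle_gap_le_grad_norm_mul_dist
    {E₁ : Type*} [NormedAddCommGroup E₁] [InnerProductSpace ℝ E₁]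
    {E₂ : Type*} [NormedAddCommGroup E₂] [InnerProductSpace ℝ E₂]
    (f : E₁ × E₂ → ℝ) (hf : Differentiable ℝ f)
    (hconv : ∀ y : E₂, ConvexOn ℝ Set.univ fun x => f (x, y))
    (hconc : ∀ x : E₁, ConcaveOn ℝ Set.univ fun y => f (x, y))
    (x₀ : E₁) (y₀ : E₂) (g₁ : E₁) (g₂ : E₂)
    (hg₁ : HasFDerivAt (fun x => f (x, y₀)) (innerSL ℝ g₁) x₀)
    (hg₂ : HasFDerivAt (fun y => f (x₀, y)) (innerSL ℝ g₂) y₀) :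
    ∀ (x : E₁) (y : E₂),
      f (x₀, y) - f (x, y₀) ≤
        Real.sqrt (‖g₁‖ ^ 2 + ‖g₂‖ ^ 2) *
          Real.sqrt (‖x₀ - x‖ ^ 2 + ‖y₀ - y‖ ^ 2) := by
  intro x y
  have h1 := convex_grad_ineq_aux _ (hconv y₀) x₀ g₁ hg₁ x
  have h2 := convex_grad_ineq_aux _ (hconc x₀).neg y₀ (-g₂) (by
    rw [map_neg]; exact hg₂.neg) y
  simp only [Pi.neg_apply, norm_neg] at h2
  refine le_trans (b := ‖g₁‖ * ‖x₀ - x‖ + ‖g₂‖ * ‖y₀ - y‖) (by linarith) ?_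
  rw [← Real.sqrt_mul (by positivity)]
  apply Real.le_sqrt_of_sq_le
  nlinarith [sq_nonneg (‖g₁‖ * ‖y₀ - y‖ - ‖g₂‖ * ‖x₀ - x‖)]
end

section
/- Let κ ≤ K be real numbers, not both zero, and set K_m = max(|κ|, |K|). Define s(κ, t) = sinh(√(−κ) t)/√(−κ) if κ < 0 and s(κ, t) = t if κ ≥ 0; define S(K, t) = sin(√K t)/√K if K > 0 and S(K, t) = t if K ≤ 0. Then for every t with 0 < t ≤ 1/√K_m, one has s(κ, t) ≤ 3 · S(K, t). -/
/-- The comparison function `s(κ, t)` bounding Jacobi field growth from above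
(Definition B.1 of the paper). -/
noncomputable def jacobiLower (κ t : ℝ) : ℝ :=
  if κ < 0 then Real.sinh (Real.sqrt (-κ) * t) / Real.sqrt (-κ) else t

/-- The comparison function `S(K, t)` bounding Jacobi field growth from below
(Definition B.1 of the paper). -/
noncomputable def jacobiUpper (K t : ℝ) : ℝ :=
  if 0 < K then Real.sin (Real.sqrt K * t) / Real.sqrt K else t

theorem sinh_aux {x : ℝ} (h0 : 0 ≤ x) (h1 : x ≤ 1) : Real.sinh x ≤ 2 * x := by
  have h := Real.abs_exp_sub_one_sub_id_le (x := x) (by rw [abs_of_nonneg h0]; exact h1)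
  have h2 := (abs_le.1 h).2
  have h3 := Real.add_one_le_exp (-x)
  rw [Real.sinh_eq]
  nlinarith

theorem sin_aux {x : ℝ} (h0 : 0 ≤ x) (h1 : x ≤ 1) : 2 * x ≤ 3 * Real.sin x := by
  have h := Real.sin_ge_sub_cube h0
  have h2 : x ^ 2 ≤ 1 := by nlinarith
  nlinarith [mul_le_mul_of_nonneg_left h2 h0]

/-- Lemma C.4 (from Wang et al. 2023): for curvature bounds `κ ≤ K` not both zero and
`K_m = max(|κ|, |K|)`, one has `s(κ, t) ≤ 3 S(K, t)` for all `0 < t ≤ 1/√K_m`. -/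
theorem jacobi_ratio_le_three (κ K : ℝ) (hκK : κ ≤ K) (hne : ¬(κ = 0 ∧ K = 0)) :
    ∀ t : ℝ, 0 < t → t ≤ 1 / Real.sqrt (max |κ| |K|) →
      jacobiLower κ t ≤ 3 * jacobiUpper K t := by
  intro t ht htm
  have hm : 0 < max |κ| |K| := by
    by_cases h : κ = 0
    · exact lt_max_of_lt_right (abs_pos.2 fun hK => hne ⟨h, hK⟩)
    · exact lt_max_of_lt_left (abs_pos.2 h)
  rw [le_div_iff₀ (Real.sqrt_pos.2 hm)] at htm
  have key : ∀ a : ℝ, a ≤ max |κ| |K| → Real.sqrt a * t ≤ 1 := fun a ha => by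
    nlinarith [mul_le_mul_of_nonneg_right (Real.sqrt_le_sqrt ha) ht.le]
  have hl : jacobiLower κ t ≤ 2 * t := by
    unfold jacobiLower
    split_ifs with h
    · have hs : 0 < Real.sqrt (-κ) := Real.sqrt_pos.2 (by linarith)
      rw [div_le_iff₀ hs]
      have := sinh_aux (mul_pos hs ht).le (key _ ((neg_le_abs κ).trans (le_max_left _ _)))
      linarith
    · linarith
  have hu : 2 * t ≤ 3 * jacobiUpper K t := by
    unfold jacobiUpper
    split_ifs with h
    · have hs : 0 < Real.sqrt K := Real.sqrt_pos.2 h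
      rw [← mul_div_assoc, le_div_iff₀ hs]
      have := sin_aux (mul_pos hs ht).le (key _ ((le_abs_self K).trans (le_max_right _ _)))
      linarith
    · linarith
  exact hl.trans hu
end
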